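/- Let H be a homogeneous degree-3 foliation of ℙ²(ℂ) given by ω = A dx + B dy (A, B ∈ ℂ[x,y] homogeneous of degree 3, gcd(A,B) = 1), with C_H = xA + yB and D_H = A_x B_y − A_y B_x. Suppose D_H is reduced: D_H = c·ℓ₁ℓ₂ℓ₃ℓ₄ with c ∈ ℂ* and ℓ₁, ℓ₂, ℓ₃, ℓ₄ pairwise non-proportional linear forms. Then not all four lines divide C_H, and, according to how many of the ℓᵢ divide C_H, ω is linearly conjugate to one of the following: (1) if exactly three divide C_H (type 3·R₁ + 1·T₁): y²((2r+3)x − (r+2)y)dx − x²(x+ry)dy with r(r+1)(r+2)(r+3)(2r+3) ≠ 0; (2) if exactly two divide C_H (type 2·R₁ + 2·T₁): s·y²((2r+3)x − (r+2)y)dx − x²(x+ry)dy with rs(s−1)(r+1)(r+2)(r+3)(2r+3)(s(2r+3)² − r²) ≠ 0; (3) if exactly one divides C_H (type 1·R₁ + 3·T₁): t·y²((2r+3)x − (r+2)y)dx − x²(x+ry)·d(sy − x) with rst(r+1)(r+2)(r+3)(2r+3)(s−t−1)(tu³ − r²su − r²v) ≠ 0, where u = 2r+3 and v = r(r+2); (4)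 if none divides C_H (type 4·T₁): u·y²((2r+3)x − (r+2)y)·d(y − sx) − x²(x+ry)·d(ty − x) with ur(r+1)(r+2)(r+3)(2r+3)(st−1)(su+t−u−1)(uv⁴ + suwv³ + r²twv + r²w²) ≠ 0, where v = 2r+3 and w = r(r+2). Moreover these four models are respectively of types 3·R₁+1·T₁, 2·R₁+2·T₁, 1·R₁+3·T₁ and 4·T₁. -/

import Mathlib

open MvPolynomial

noncomputable section

/-- The linear form `a·x + b·y ∈ ℂ[x,y]` attached to a pair `(a, b) ∈ ℂ²`. -/
def lin (v : ℂ × ℂ) : MvPolynomial (Fin 2) ℂ := C v.1 * X 0 + C v.2 * X 1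

/-- Substitution of the linear change of variables on `ℂ²` given by the matrix `M`. -/
def subst2 (M : Matrix (Fin 2) (Fin 2) ℂ) (P : MvPolynomial (Fin 2) ℂ) :
    MvPolynomial (Fin 2) ℂ :=
  aeval (fun i => ∑ j, C (M i j) * X j) P

/-- The 1-forms `ω = A dx + B dy` and `ω' = A' dx + B' dy` are linearly conjugate:
there are `T ∈ GL₂(ℂ)` and `c ∈ ℂ*` with `T*ω = c·ω'`. -/
def LinConj2 (A B A' B' : MvPolynomial (Fin 2) ℂ) : Prop :=
  ∃ (M : Matrix (Fin 2) (Fin 2) ℂ) (c : ℂ), IsUnit M.det ∧ c ≠ 0 ∧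
    C (M 0 0) * subst2 M A + C (M 1 0) * subst2 M B = C c * A' ∧
    C (M 0 1) * subst2 M A + C (M 1 1) * subst2 M B = C c * B'

/-- The inflection polynomial `D = A_x·B_y − A_y·B_x` of the homogeneous 1-form
`ω = A dx + B dy`. -/
def Dpoly (A B : MvPolynomial (Fin 2) ℂ) : MvPolynomial (Fin 2) ℂ :=
  pderiv 0 A * pderiv 1 B - pderiv 1 A * pderiv 0 B

/-- The tangent cone `C = x·A + y·B` of the homogeneous 1-form `ω = A dx + B dy`. -/
def cone (A B : MvPolynomial (Fin 2) ℂ) : MvPolynomial (Fin 2) ℂ :=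
  X 0 * A + X 1 * B

/-- The first normal-form coefficient `y²((2r+3)x − (r+2)y)`. -/
def m1A (r : ℂ) : MvPolynomial (Fin 2) ℂ :=
  X 1 ^ 2 * (C (2 * r + 3) * X 0 - C (r + 2) * X 1)

/-- The second normal-form coefficient `−x²(x + ry)`. -/
def m1B (r : ℂ) : MvPolynomial (Fin 2) ℂ :=
  -(X 0 ^ 2 * (X 0 + C r * X 1))

/-- The homogeneous 1-form `A dx + B dy` has reduced inflection divisor of type with
exactly `k` radial lines: `D = c·ℓ₁ℓ₂ℓ₃ℓ₄` with pairwise non-proportional linear forms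
of which exactly `k` divide the tangent cone `C = xA + yB`. -/
def HasRedType (A B : MvPolynomial (Fin 2) ℂ) (k : ℕ) : Prop :=
  ∃ (c : ℂ) (L : Fin 4 → ℂ × ℂ), c ≠ 0 ∧
    (∀ i j, i ≠ j → (L i).1 * (L j).2 - (L j).1 * (L i).2 ≠ 0) ∧
    Dpoly A B = C c * ∏ i, lin (L i) ∧
    Set.ncard {i : Fin 4 | lin (L i) ∣ cone A B} = k

lemma cubic_form (A : MvPolynomial (Fin 2) ℂ) (hA : A.IsHomogeneous 3) :
    ∃ a b c d : ℂ, A = C a * X 0 ^ 3 + C b * (X 0 ^ 2 * X 1) + C c * (X 0 * X 1 ^ 2)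
      + C d * X 1 ^ 3 := by
  refine ⟨coeff (Finsupp.single 0 3) A, coeff (Finsupp.single 0 2 + Finsupp.single 1 1) A,
    coeff (Finsupp.single 0 1 + Finsupp.single 1 2) A, coeff (Finsupp.single 1 3) A, ?_⟩
  have e1 : (X 0 ^ 3 : MvPolynomial (Fin 2) ℂ) = monomial (Finsupp.single 0 3) 1 := by
    rw [X_pow_eq_monomial]
  have e4 : (X 1 ^ 3 : MvPolynomial (Fin 2) ℂ) = monomial (Finsupp.single 1 3) 1 := by
    rw [X_pow_eq_monomial]
  have e2 : (X 0 ^ 2 * X 1 : MvPolynomial (Fin 2) ℂ)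
      = monomial (Finsupp.single 0 2 + Finsupp.single 1 1) 1 := by
    rw [X_pow_eq_monomial, X, monomial_mul, one_mul]
  have e3 : (X 0 * X 1 ^ 2 : MvPolynomial (Fin 2) ℂ)
      = monomial (Finsupp.single 0 1 + Finsupp.single 1 2) 1 := by
    rw [X_pow_eq_monomial, X, monomial_mul, one_mul]
  rw [e1, e2, e3, e4]
  ext m
  simp only [coeff_add, coeff_C_mul, coeff_monomial]
  by_cases h : m.degree = 3
  · have h' : m 0 + m 1 = 3 := by
      rw [← h, Finsupp.degree_eq_sum]; simp
    have hm : m = Finsupp.single 0 (m 0) + Finsupp.single 1 (m 1) := by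
      ext i; fin_cases i <;> simp
    have hh : (m 0 = 0 ∧ m 1 = 3) ∨ (m 0 = 1 ∧ m 1 = 2) ∨ (m 0 = 2 ∧ m 1 = 1) ∨
      (m 0 = 3 ∧ m 1 = 0) := by omega
    rcases hh with ⟨h0, h1⟩ | ⟨h0, h1⟩ | ⟨h0, h1⟩ | ⟨h0, h1⟩ <;> rw [h0, h1] at hm <;> subst hm <;>
      simp [Finsupp.ext_iff, Fin.forall_fin_two]
  · rw [hA.coeff_eq_zero h]
    have : ∀ n : Fin 2 →₀ ℕ, n.degree = 3 → n ≠ m := fun n hn hnm => h (hnm ▸ hn)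
    rw [if_neg (this _ (by simp)), if_neg (this _ (by simp [map_add])),
      if_neg (this _ (by simp [map_add])), if_neg (this _ (by simp))]
    simp

lemma pderiv_subst2 (M : Matrix (Fin 2) (Fin 2) ℂ) (P : MvPolynomial (Fin 2) ℂ) (i : Fin 2) :
    pderiv i (subst2 M P) = C (M 0 i) * subst2 M (pderiv 0 P) + C (M 1 i) * subst2 M (pderiv 1 P) := by
  induction P using MvPolynomial.induction_on with
  | C a => simp [subst2]
  | add p q hp hq =>
    simp only [subst2, map_add] at *
    rw [hp, hq]; ring
  | mul_X p j hp =>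
    simp only [subst2, map_mul, Derivation.leibniz, aeval_X, smul_eq_mul, map_add] at *
    rw [hp]
    fin_cases j <;> fin_cases i <;> simp [pderiv_X] <;> ring

lemma eval_subst2 (M : Matrix (Fin 2) (Fin 2) ℂ) (P : MvPolynomial (Fin 2) ℂ) (z : Fin 2 → ℂ) :
    eval z (subst2 M P) = eval (fun i => ∑ j, M i j * z j) P := by
  induction P using MvPolynomial.induction_on with
  | C a => simp [subst2]
  | add p q hp hq =>
    simp only [subst2, map_add] at *
    rw [hp, hq]
  | mul_X p j hp =>
    simp only [subst2, map_mul] at *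
    rw [hp]; simp

/-- the transformed pair -/
def tA (M : Matrix (Fin 2) (Fin 2) ℂ) (A B : MvPolynomial (Fin 2) ℂ) : MvPolynomial (Fin 2) ℂ :=
  C (M 0 0) * subst2 M A + C (M 1 0) * subst2 M B

/-- the transformed pair -/
def tB (M : Matrix (Fin 2) (Fin 2) ℂ) (A B : MvPolynomial (Fin 2) ℂ) : MvPolynomial (Fin 2) ℂ :=
  C (M 0 1) * subst2 M A + C (M 1 1) * subst2 M B

lemma Dpoly_t (M : Matrix (Fin 2) (Fin 2) ℂ) (A B : MvPolynomial (Fin 2) ℂ) :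
    Dpoly (tA M A B) (tB M A B) = C (M.det ^ 2) * subst2 M (Dpoly A B) := by
  simp only [Dpoly, tA, tB, map_add, pderiv_C_mul, pderiv_subst2, Matrix.det_fin_two]
  have h : ∀ p q, subst2 M (p * q) = subst2 M p * subst2 M q := fun p q => by simp [subst2]
  have h' : ∀ p q, subst2 M (p - q) = subst2 M p - subst2 M q := fun p q => by simp [subst2]
  rw [h', h, h]
  simp only [map_pow, map_sub, map_mul]
  ring

lemma eval_cone_t (M : Matrix (Fin 2) (Fin 2) ℂ) (A B : MvPolynomial (Fin 2) ℂ) (z : Fin 2 → ℂ) :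
    eval z (cone (tA M A B) (tB M A B)) = eval (fun i => ∑ j, M i j * z j) (cone A B) := by
  simp only [cone, tA, tB, map_add, map_mul, eval_X, eval_C, eval_subst2, Fin.sum_univ_two]
  ring

lemma subst2_hom {n : ℕ} (M : Matrix (Fin 2) (Fin 2) ℂ) (A : MvPolynomial (Fin 2) ℂ)
    (hA : A.IsHomogeneous n) : (subst2 M A).IsHomogeneous n := by
  have := hA.aeval (fun i => ∑ j, C (M i j) * X j) (n := 1) (fun i => by
    apply IsHomogeneous.sum
    intro j _
    exact isHomogeneous_C_mul_X _ _)
  simpa [subst2] using this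

lemma tA_hom (M : Matrix (Fin 2) (Fin 2) ℂ) (A B : MvPolynomial (Fin 2) ℂ)
    (hA : A.IsHomogeneous 3) (hB : B.IsHomogeneous 3) : (tA M A B).IsHomogeneous 3 :=
  ((subst2_hom M A hA).C_mul _).add ((subst2_hom M B hB).C_mul _)

lemma tB_hom (M : Matrix (Fin 2) (Fin 2) ℂ) (A B : MvPolynomial (Fin 2) ℂ)
    (hA : A.IsHomogeneous 3) (hB : B.IsHomogeneous 3) : (tB M A B).IsHomogeneous 3 :=
  ((subst2_hom M A hA).C_mul _).add ((subst2_hom M B hB).C_mul _)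

lemma quartic_dvd (P : MvPolynomial (Fin 2) ℂ) (e0 e1 e2 e3 e4 a b : ℂ)
    (hP : P = C e0 * X 0 ^ 4 + C e1 * (X 0 ^ 3 * X 1) + C e2 * (X 0 ^ 2 * X 1 ^ 2)
      + C e3 * (X 0 * X 1 ^ 3) + C e4 * X 1 ^ 4) (h : a ≠ 0 ∨ b ≠ 0)
    (h0 : e0 * b ^ 4 - e1 * b ^ 3 * a + e2 * b ^ 2 * a ^ 2 - e3 * b * a ^ 3 + e4 * a ^ 4 = 0) :
    lin (a, b) ∣ P := by
  have h0' := congrArg (C (σ := Fin 2)) h0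
  simp only [map_add, map_sub, map_mul, map_pow, map_zero] at h0'
  rcases h with h | h
  · have hu : IsUnit (C (σ := Fin 2) (a ^ 4)) := (isUnit_iff_ne_zero.mpr (pow_ne_zero 4 h)).map C
    rw [← hu.dvd_mul_left]
    refine ⟨C e0 * (C a * X 0 - C b * X 1) * ((C a * X 0) ^ 2 + (C b * X 1) ^ 2)
      + C e1 * C a * X 1 * ((C a * X 0) ^ 2 - (C a * X 0) * (C b * X 1) + (C b * X 1) ^ 2)
      + C e2 * C a ^ 2 * X 1 ^ 2 * (C a * X 0 - C b * X 1) + C e3 * C a ^ 3 * X 1 ^ 3, ?_⟩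
    rw [hP]
    simp only [lin, map_pow]
    linear_combination X 1 ^ 4 * h0'
  · have hu : IsUnit (C (σ := Fin 2) (b ^ 4)) := (isUnit_iff_ne_zero.mpr (pow_ne_zero 4 h)).map C
    rw [← hu.dvd_mul_left]
    refine ⟨C e4 * (C b * X 1 - C a * X 0) * ((C a * X 0) ^ 2 + (C b * X 1) ^ 2)
      + C e3 * C b * X 0 * ((C a * X 0) ^ 2 - (C a * X 0) * (C b * X 1) + (C b * X 1) ^ 2)
      + C e2 * C b ^ 2 * X 0 ^ 2 * (C b * X 1 - C a * X 0) + C e1 * C b ^ 3 * X 0 ^ 3, ?_⟩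
    rw [hP]
    simp only [lin, map_pow]
    linear_combination X 0 ^ 4 * h0'

lemma lin_dvd_iff (A B : MvPolynomial (Fin 2) ℂ)
    (hA : A.IsHomogeneous 3) (hB : B.IsHomogeneous 3) (v : ℂ × ℂ) (hv : v.1 ≠ 0 ∨ v.2 ≠ 0) :
    lin v ∣ cone A B ↔ eval ![-v.2, v.1] (cone A B) = 0 := by
  constructor
  · rintro ⟨Q, hQ⟩
    rw [hQ]; simp [lin]; left; ring
  · obtain ⟨a0, a1, a2, a3, rfl⟩ := cubic_form A hA
    obtain ⟨b0, b1, b2, b3, rfl⟩ := cubic_form B hB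
    intro h
    refine quartic_dvd _ a0 (a1 + b0) (a2 + b1) (a3 + b2) b3 v.1 v.2 ?_ hv ?_
    · simp only [cone, map_add]; ring
    · simp [cone] at h
      linear_combination h

lemma cone_scale (A B : MvPolynomial (Fin 2) ℂ)
    (hA : A.IsHomogeneous 3) (hB : B.IsHomogeneous 3) (t x y : ℂ) :
    eval ![t * x, t * y] (cone A B) = t ^ 4 * eval ![x, y] (cone A B) := by
  obtain ⟨a0, a1, a2, a3, rfl⟩ := cubic_form A hA
  obtain ⟨b0, b1, b2, b3, rfl⟩ := cubic_form B hB
  simp [cone]; ring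

lemma m1A_hom (r : ℂ) : (m1A r).IsHomogeneous 3 :=
  ((isHomogeneous_X_pow (R := ℂ) (1 : Fin 2) 2).mul
    ((isHomogeneous_C_mul_X (2 * r + 3) (0 : Fin 2)).sub (isHomogeneous_C_mul_X (r + 2) 1)) :)

lemma m1B_hom (r : ℂ) : (m1B r).IsHomogeneous 3 :=
  (((isHomogeneous_X_pow (R := ℂ) (0 : Fin 2) 2).mul
    ((isHomogeneous_X ℂ (0 : Fin 2)).add (isHomogeneous_C_mul_X r 1))).neg :)

/-- the critical lines of the model -/
def Lr (r : ℂ) : Fin 4 → ℂ × ℂ := ![(1, 0), (0, 1), (1, -1), (2 * r + 3, r * (r + 2))]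

lemma model_iff (r n11 n12 n21 n22 : ℂ) (hr1 : r + 1 ≠ 0) (hr2 : r + 2 ≠ 0)
    (hr4 : 2 * r + 3 ≠ 0) :
    (lin (Lr r 0) ∣ cone (C n11 * m1A r + C n12 * m1B r) (C n21 * m1A r + C n22 * m1B r)
      ↔ n21 = 0) ∧
    (lin (Lr r 1) ∣ cone (C n11 * m1A r + C n12 * m1B r) (C n21 * m1A r + C n22 * m1B r)
      ↔ n12 = 0) ∧
    (lin (Lr r 2) ∣ cone (C n11 * m1A r + C n12 * m1B r) (C n21 * m1A r + C n22 * m1B r)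
      ↔ n11 + n21 - n12 - n22 = 0) ∧
    (lin (Lr r 3) ∣ cone (C n11 * m1A r + C n12 * m1B r) (C n21 * m1A r + C n22 * m1B r)
      ↔ -(r * (r + 2)) * (n11 * (2 * r + 3) ^ 3 + n12 * (r ^ 2 * (r * (r + 2))))
        + (2 * r + 3) * (n21 * (2 * r + 3) ^ 3 + n22 * (r ^ 2 * (r * (r + 2)))) = 0) := by
  have hA := ((m1A_hom r).C_mul n11).add ((m1B_hom r).C_mul n12)
  have hB := ((m1A_hom r).C_mul n21).add ((m1B_hom r).C_mul n22)
  refine ⟨?_, ?_, ?_, ?_⟩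
  · rw [lin_dvd_iff _ _ hA hB _ (by simp [Lr])]
    have : eval ![-(Lr r 0).2, (Lr r 0).1] (cone (C n11 * m1A r + C n12 * m1B r)
      (C n21 * m1A r + C n22 * m1B r)) = -(r + 2) * n21 := by
      simp [cone, Lr, m1A, m1B]; ring
    rw [this, mul_eq_zero, neg_eq_zero, or_iff_right hr2]
  · rw [lin_dvd_iff _ _ hA hB _ (by simp [Lr])]
    have : eval ![-(Lr r 1).2, (Lr r 1).1] (cone (C n11 * m1A r + C n12 * m1B r)
      (C n21 * m1A r + C n22 * m1B r)) = -n12 := by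
      simp [cone, Lr, m1A, m1B]
    rw [this, neg_eq_zero]
  · rw [lin_dvd_iff _ _ hA hB _ (by simp [Lr])]
    have : eval ![-(Lr r 2).2, (Lr r 2).1] (cone (C n11 * m1A r + C n12 * m1B r)
      (C n21 * m1A r + C n22 * m1B r)) = (r + 1) * (n11 + n21 - n12 - n22) := by
      simp [cone, Lr, m1A, m1B]; ring
    rw [this, mul_eq_zero, or_iff_right hr1]
  · rw [lin_dvd_iff _ _ hA hB _ (by left; simpa [Lr] using hr4)]
    have : eval ![-(Lr r 3).2, (Lr r 3).1] (cone (C n11 * m1A r + C n12 * m1B r)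
      (C n21 * m1A r + C n22 * m1B r)) = -((r + 1) * (r + 2)) *
       (-(r * (r + 2)) * (n11 * (2 * r + 3) ^ 3 + n12 * (r ^ 2 * (r * (r + 2))))
        + (2 * r + 3) * (n21 * (2 * r + 3) ^ 3 + n22 * (r ^ 2 * (r * (r + 2))))) := by
      simp [cone, Lr, m1A, m1B]; ring
    rw [this, mul_eq_zero, neg_eq_zero, or_iff_right (mul_ne_zero hr1 hr2)]

lemma model_D (r n11 n12 n21 n22 : ℂ) :
    Dpoly (C n11 * m1A r + C n12 * m1B r) (C n21 * m1A r + C n22 * m1B r)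
      = C (6 * (n11 * n22 - n12 * n21)) * ∏ i, lin (Lr r i) := by
  simp [Dpoly, m1A, m1B, Fin.prod_univ_four, Lr, lin, pderiv_X, Derivation.leibniz_pow]
  have h2 : (C (σ := Fin 2) (2 : ℂ)) = 2 := map_ofNat C 2
  have h3 : (C (σ := Fin 2) (3 : ℂ)) = 3 := map_ofNat C 3
  have h6 : (C (σ := Fin 2) (6 : ℂ)) = 6 := map_ofNat C 6
  simp only [h2, h3, h6]
  ring

lemma model_L (r : ℂ) (hr0 : r ≠ 0) (hr1 : r + 1 ≠ 0) (hr2 : r + 2 ≠ 0) (hr3 : r + 3 ≠ 0)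
    (hr4 : 2 * r + 3 ≠ 0) :
    ∀ i j, i ≠ j → (Lr r i).1 * (Lr r j).2 - (Lr r j).1 * (Lr r i).2 ≠ 0 := by
  have h13 := mul_ne_zero hr1 hr3
  have h02 := mul_ne_zero hr0 hr2
  intro i j hij
  fin_cases i <;> fin_cases j <;> first | exact absurd rfl hij | skip
  all_goals simp [Lr]
  all_goals first
    | assumption
    | exact ⟨hr0, hr2⟩
    | (intro h; apply hr4; linear_combination h; done)
    | (intro h; apply hr4; linear_combination -h; done)
    | (intro h; apply h13; linear_combination h)
    | (intro h; apply h13; linear_combination -h)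

lemma norm_core (A B : MvPolynomial (Fin 2) ℂ)
    (hA : A.IsHomogeneous 3) (hB : B.IsHomogeneous 3)
    (c : ℂ) (hc : c ≠ 0) (L : Fin 4 → ℂ × ℂ)
    (hL : ∀ i j, i ≠ j → (L i).1 * (L j).2 - (L j).1 * (L i).2 ≠ 0)
    (hfac : Dpoly A B = C c * ∏ i, lin (L i))
    (h0 : (L 0).2 = 0) (h1 : (L 1).1 = 0) (h2 : (L 2).2 = -(L 2).1) :
    ∃ r n11 n12 n21 n22 : ℂ, r ≠ 0 ∧ r + 1 ≠ 0 ∧ r + 2 ≠ 0 ∧ r + 3 ≠ 0 ∧ 2 * r + 3 ≠ 0 ∧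
      n11 * n22 - n12 * n21 ≠ 0 ∧
      A = C n11 * m1A r + C n12 * m1B r ∧ B = C n21 * m1A r + C n22 * m1B r ∧
      ∀ i, (L i).1 * (Lr r i).2 = (L i).2 * (Lr r i).1 := by
  obtain ⟨a0, a1, a2, a3, rfl⟩ := cubic_form A hA
  obtain ⟨b0, b1, b2, b3, rfl⟩ := cubic_form B hB
  have h01 := hL 0 1 (by decide)
  have h02 := hL 0 2 (by decide)
  have h03 := hL 0 3 (by decide)
  have h13 := hL 1 3 (by decide)
  have h23 := hL 2 3 (by decide)
  rw [h0, h1] at h01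
  rw [h0, h2] at h02
  rw [h0] at h03
  rw [h1] at h13
  rw [h2] at h23
  obtain ⟨p0, hp0⟩ : ∃ p, p = (L 0).1 := ⟨_, rfl⟩
  obtain ⟨q1, hq1⟩ : ∃ p, p = (L 1).2 := ⟨_, rfl⟩
  obtain ⟨p2, hp2⟩ : ∃ p, p = (L 2).1 := ⟨_, rfl⟩
  obtain ⟨p, hp⟩ : ∃ p, p = (L 3).1 := ⟨_, rfl⟩
  obtain ⟨q, hq⟩ : ∃ p, p = (L 3).2 := ⟨_, rfl⟩
  rw [← hp0, ← hq1] at h01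
  rw [← hp0, ← hp2] at h02
  rw [← hp0, ← hp, ← hq] at h03
  rw [← hq1, ← hp, ← hq] at h13
  rw [← hp2, ← hp, ← hq] at h23
  have hp0' : p0 ≠ 0 := by rintro rfl; simp at h01
  have hq1' : q1 ≠ 0 := by rintro rfl; simp at h01
  have hp2' : p2 ≠ 0 := by rintro rfl; simp at h02
  have hp' : p ≠ 0 := by rintro rfl; simp at h13
  have hq' : q ≠ 0 := by rintro rfl; simp at h03
  have hpq : p + q ≠ 0 := by
    intro h; apply h23; linear_combination p2 * h
  obtain ⟨K, hK⟩ : ∃ K, K = c * p0 * q1 * p2 := ⟨_, rfl⟩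
  have hK0 : K ≠ 0 := by rw [hK]; positivity
  have key : ∀ x y : ℂ, (3 * a0 * x ^ 2 + 2 * a1 * x * y + a2 * y ^ 2) *
      (b1 * x ^ 2 + 2 * b2 * x * y + 3 * b3 * y ^ 2) -
      (a1 * x ^ 2 + 2 * a2 * x * y + 3 * a3 * y ^ 2) *
      (3 * b0 * x ^ 2 + 2 * b1 * x * y + b2 * y ^ 2) = K * (x * y * (x - y) * (p * x + q * y)) := by
    intro x y
    have := congrArg (eval ![x, y]) hfac
    simp [Dpoly, Fin.prod_univ_four, lin, h0, h1, h2, ← hp0, ← hq1, ← hp2, ← hp, ← hq,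
      pderiv_X, Derivation.leibniz_pow] at this
    rw [hK]
    linear_combination this
  have k1 := key 1 0
  have k2 := key 0 1
  have k3 := key 1 1
  have k4 := key 1 (-1)
  have k5 := key 2 1
  clear key
  have e0 : a0 * b1 - a1 * b0 = 0 := by linear_combination k1 / 3
  have e4 : a2 * b3 - a3 * b2 = 0 := by linear_combination k2 / 3
  have e1 : 6 * (a0 * b2 - a2 * b0) = K * p := by
    linear_combination (k5 - 3 * k3 - k4) / 6 - 2 * k1 + k2 / 2
  have e3 : 6 * (a1 * b3 - a3 * b1) = -(K * q) := by
    linear_combination (6 * k3 - 2 * k4 - k5) / 6 + 2 * k1 - k2 / 2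
  have e2 : 9 * (a0 * b3 - a3 * b0) + 3 * (a1 * b2 - a2 * b1) = K * (q - p) := by
    linear_combination (k3 + k4) / 2 - k1 - k2
  clear k1 k2 k3 k4 k5
  -- proportionality
  have prop : ∀ x y x' y' : ℂ, x * y' - x' * y = 0 → (x ≠ 0 ∨ y ≠ 0) →
      ∃ t, x' = t * x ∧ y' = t * y := by
    intro x y x' y' h hh
    rcases hh with hh | hh
    · refine ⟨x' / x, by field_simp, ?_⟩
      field_simp; linear_combination h
    · refine ⟨y' / y, ?_, by field_simp⟩
      field_simp; linear_combination -h
  have hKp : K * p ≠ 0 := mul_ne_zero hK0 hp'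
  have hKq : K * q ≠ 0 := mul_ne_zero hK0 hq'
  obtain ⟨r, rfl, rfl⟩ := prop a0 b0 a1 b1 e0 (by
    by_contra! h
    apply hKp; rw [← e1, h.1, h.2]; ring)
  obtain ⟨σ, rfl, rfl⟩ := prop a3 b3 a2 b2 (by linear_combination -e4) (by
    by_contra! h
    apply hKq
    have := e3
    rw [h.1, h.2] at this
    linear_combination this)
  obtain ⟨Δ, hΔ⟩ : ∃ Δ, Δ = a0 * b3 - a3 * b0 := ⟨_, rfl⟩
  have f1 : 6 * σ * Δ = K * p := by rw [hΔ]; linear_combination e1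
  have f3 : 6 * r * Δ = -(K * q) := by rw [hΔ]; linear_combination e3
  have hΔ0 : Δ ≠ 0 := by rintro h; rw [h] at f1; apply hKp; linear_combination -f1
  have hr0 : r ≠ 0 := by rintro h; rw [h] at f3; apply hKq; linear_combination f3
  have hσ0 : σ ≠ 0 := by rintro h; rw [h] at f1; apply hKp; linear_combination -f1
  have hs : σ * (r + 2) + (2 * r + 3) = 0 := by
    apply mul_left_cancel₀ hΔ0
    rw [hΔ]
    linear_combination (e2 + e1 + e3) / 3
  have hr2 : r + 2 ≠ 0 := by
    intro h
    have h3 : (2 * r + 3 : ℂ) = 0 := by linear_combination hs - σ * h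
    have : (1 : ℂ) = 0 := by linear_combination 2 * h - h3
    exact one_ne_zero this
  have hr4 : 2 * r + 3 ≠ 0 := by
    intro h
    apply mul_ne_zero hσ0 hr2; linear_combination hs - h
  have hne : (r + 1) * (r + 3) ≠ 0 := by
    intro h
    have h1 : σ = r := by
      apply mul_right_cancel₀ hr2; linear_combination hs - h
    apply mul_ne_zero hK0 hpq
    rw [h1] at f1
    linear_combination f3 - f1
  have hσ : σ = -(2 * r + 3) / (r + 2) := by
    field_simp; linear_combination hs
  have hw : (C (σ := Fin 2) (r + 2)) * C ((r + 2)⁻¹) = 1 := by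
    rw [← C_mul, mul_inv_cancel₀ hr2, C_1]
  refine ⟨r, -a3 * (r + 2)⁻¹, -a0, -b3 * (r + 2)⁻¹, -b0, hr0, left_ne_zero_of_mul hne, hr2,
    right_ne_zero_of_mul hne, hr4, ?_, ?_, ?_, ?_⟩
  · have : -a3 * (r + 2)⁻¹ * -b0 - -a0 * (-b3 * (r + 2)⁻¹) = -Δ * (r + 2)⁻¹ := by
      rw [hΔ]; ring
    rw [this]
    exact mul_ne_zero (neg_ne_zero.mpr hΔ0) (inv_ne_zero hr2)
  · rw [hσ, div_eq_mul_inv]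
    simp only [m1A, m1B, C_mul, C_neg]
    linear_combination -C a3 * X 1 ^ 3 * hw
  · rw [hσ, div_eq_mul_inv]
    simp only [m1A, m1B, C_mul, C_neg]
    linear_combination -C b3 * X 1 ^ 3 * hw
  · have hfin : p * (r * (r + 2)) = q * (2 * r + 3) := by
      apply mul_left_cancel₀ hK0
      linear_combination (-r * (r + 2)) * f1 - (2 * r + 3) * f3 + 6 * r * Δ * hs
    intro i
    fin_cases i
    · simp [Lr, h0]
    · simp [Lr, h1]
    · simp [Lr, h2]
    · simpa [Lr, ← hp, ← hq] using hfin

lemma subst2_lin (M : Matrix (Fin 2) (Fin 2) ℂ) (v : ℂ × ℂ) :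
    subst2 M (lin v) = lin (v.1 * M 0 0 + v.2 * M 1 0, v.1 * M 0 1 + v.2 * M 1 1) := by
  simp [subst2, lin]; ring

lemma core (A B : MvPolynomial (Fin 2) ℂ)
    (hA : A.IsHomogeneous 3) (hB : B.IsHomogeneous 3)
    (c : ℂ) (hc : c ≠ 0) (L : Fin 4 → ℂ × ℂ)
    (hL : ∀ i j, i ≠ j → (L i).1 * (L j).2 - (L j).1 * (L i).2 ≠ 0)
    (hfac : Dpoly A B = C c * ∏ i, lin (L i)) :
    ∃ (M : Matrix (Fin 2) (Fin 2) ℂ) (r n11 n12 n21 n22 : ℂ), IsUnit M.det ∧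
      r ≠ 0 ∧ r + 1 ≠ 0 ∧ r + 2 ≠ 0 ∧ r + 3 ≠ 0 ∧ 2 * r + 3 ≠ 0 ∧
      n11 * n22 - n12 * n21 ≠ 0 ∧
      tA M A B = C n11 * m1A r + C n12 * m1B r ∧ tB M A B = C n21 * m1A r + C n22 * m1B r ∧
      ∀ i, lin (L i) ∣ cone A B ↔
        lin (Lr r i) ∣ cone (C n11 * m1A r + C n12 * m1B r) (C n21 * m1A r + C n22 * m1B r) := by
  have h01 := hL 0 1 (by decide)
  have h02 := hL 0 2 (by decide)
  have h12 := hL 1 2 (by decide)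
  obtain ⟨d01, hd01⟩ : ∃ d, d = (L 0).1 * (L 1).2 - (L 1).1 * (L 0).2 := ⟨_, rfl⟩
  obtain ⟨d02, hd02⟩ : ∃ d, d = (L 0).1 * (L 2).2 - (L 2).1 * (L 0).2 := ⟨_, rfl⟩
  obtain ⟨d12, hd12⟩ : ∃ d, d = (L 1).1 * (L 2).2 - (L 2).1 * (L 1).2 := ⟨_, rfl⟩
  obtain ⟨M, hM⟩ : ∃ M : Matrix (Fin 2) (Fin 2) ℂ,
    M = !![-d02 * (L 1).2, d12 * (L 0).2; d02 * (L 1).1, -d12 * (L 0).1] := ⟨_, rfl⟩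
  have hdet : M.det = d02 * d12 * d01 := by
    rw [hM, Matrix.det_fin_two_of, hd01]; ring
  have hdet0 : M.det ≠ 0 := by
    rw [hdet, hd01, hd02, hd12]
    exact mul_ne_zero (mul_ne_zero h02 h12) h01
  have hdet' : M 0 0 * M 1 1 - M 0 1 * M 1 0 ≠ 0 := by rwa [← Matrix.det_fin_two]
  obtain ⟨L', hL'⟩ : ∃ L' : Fin 4 → ℂ × ℂ, L' = fun i =>
    ((L i).1 * M 0 0 + (L i).2 * M 1 0, (L i).1 * M 0 1 + (L i).2 * M 1 1) := ⟨_, rfl⟩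
  have hpair : ∀ i j, i ≠ j → (L' i).1 * (L' j).2 - (L' j).1 * (L' i).2 ≠ 0 := by
    intro i j hij
    have : (L' i).1 * (L' j).2 - (L' j).1 * (L' i).2 = (M 0 0 * M 1 1 - M 0 1 * M 1 0) *
      ((L i).1 * (L j).2 - (L j).1 * (L i).2) := by
      simp only [hL']; ring
    rw [this]
    exact mul_ne_zero hdet' (hL i j hij)
  have hfac' : Dpoly (tA M A B) (tB M A B) = C (M.det ^ 2 * c) * ∏ i, lin (L' i) := by
    rw [Dpoly_t, hfac, C_mul, mul_assoc]
    congr 1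
    have : subst2 M (C c * ∏ i, lin (L i)) = C c * ∏ i, subst2 M (lin (L i)) := by
      simp [subst2]
    rw [this]
    simp only [subst2_lin, hL']
  obtain ⟨r, n11, n12, n21, n22, hr0, hr1, hr2, hr3, hr4, hN, eA, eB, hprop⟩ :=
    norm_core _ _ (tA_hom M A B hA hB) (tB_hom M A B hA hB) _
      (mul_ne_zero (pow_ne_zero 2 hdet0) hc) L' hpair hfac'
      (by simp [hL', hM]; ring) (by simp [hL', hM]; ring)
      (by simp [hL', hM, hd02, hd12]; ring)
  refine ⟨M, r, n11, n12, n21, n22, hdet0.isUnit, hr0, hr1, hr2, hr3, hr4, hN, eA, eB, ?_⟩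
  rw [← eA, ← eB]
  intro i
  have nz : ∀ K : Fin 4 → ℂ × ℂ, (∀ i j, i ≠ j → (K i).1 * (K j).2 - (K j).1 * (K i).2 ≠ 0) →
      ((K i).1 ≠ 0 ∨ (K i).2 ≠ 0) := by
    intro K hK
    by_contra! h
    apply hK i (i + 1) (by fin_cases i <;> decide)
    rw [h.1, h.2]; ring
  have n1 := nz L hL
  have n2 := nz L' hpair
  have n3 := nz (Lr r) (model_L r hr0 hr1 hr2 hr3 hr4)
  rw [lin_dvd_iff _ _ hA hB _ n1,
    lin_dvd_iff _ _ (tA_hom M A B hA hB) (tB_hom M A B hA hB) _ n3]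
  obtain ⟨t, ht0, ht1, ht2⟩ : ∃ t : ℂ, t ≠ 0 ∧ (L' i).1 = t * (Lr r i).1 ∧
      (L' i).2 = t * (Lr r i).2 := by
    have hp := hprop i
    rcases n3 with h | h
    · have e1 : (L' i).1 = (L' i).1 / (Lr r i).1 * (Lr r i).1 := by field_simp
      have e2 : (L' i).2 = (L' i).1 / (Lr r i).1 * (Lr r i).2 := by
        field_simp; linear_combination -hp
      refine ⟨_, ?_, e1, e2⟩
      intro h0
      rw [h0] at e1 e2
      simp [e1, e2] at n2
    · have e1 : (L' i).1 = (L' i).2 / (Lr r i).2 * (Lr r i).1 := by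
        field_simp; linear_combination hp
      have e2 : (L' i).2 = (L' i).2 / (Lr r i).2 * (Lr r i).2 := by field_simp
      refine ⟨_, ?_, e1, e2⟩
      intro h0
      rw [h0] at e1 e2
      simp [e1, e2] at n2
  have s1 : eval ![-(L' i).2, (L' i).1] (cone (tA M A B) (tB M A B))
      = t ^ 4 * eval ![-(Lr r i).2, (Lr r i).1] (cone (tA M A B) (tB M A B)) := by
    rw [← cone_scale _ _ (tA_hom M A B hA hB) (tB_hom M A B hA hB), ht1, ht2, mul_neg]
  have s2 : eval ![-(L' i).2, (L' i).1] (cone (tA M A B) (tB M A B))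
      = M.det ^ 4 * eval ![-(L i).2, (L i).1] (cone A B) := by
    rw [eval_cone_t, ← cone_scale _ _ hA hB]
    congr 2
    ext j
    fin_cases j
    · simp [hL', Matrix.det_fin_two]; ring
    · simp [hL', Matrix.det_fin_two]; ring
  have s3 := s1.symm.trans s2
  constructor
  · intro h
    rw [h, mul_zero] at s3
    exact (mul_eq_zero.mp s3).resolve_left (pow_ne_zero 4 ht0)
  · intro h
    rw [h, mul_zero] at s3
    exact (mul_eq_zero.mp s3.symm).resolve_left (pow_ne_zero 4 hdet0)

lemma perm_bool : ∀ f : Fin 4 → Bool, ∃ s : Equiv.Perm (Fin 4), ∀ i,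
    (f (s i) = true ↔ i.val < (Finset.univ.filter (fun i => f i = true)).card) := by
  decide +kernel

lemma perm_set (S : Set (Fin 4)) : ∃ s : Equiv.Perm (Fin 4), ∀ i, (s i ∈ S ↔ i.val < S.ncard) := by
  classical
  obtain ⟨s, hs⟩ := perm_bool (fun i => decide (i ∈ S))
  refine ⟨s, fun i => ?_⟩
  have := hs i
  simp only [decide_eq_true_eq] at this
  rw [this, Set.ncard_eq_toFinset_card']
  congr! 2
  ext; simp

lemma classify (A B : MvPolynomial (Fin 2) ℂ)
    (hA : A.IsHomogeneous 3) (hB : B.IsHomogeneous 3)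
    (c : ℂ) (hc : c ≠ 0) (L : Fin 4 → ℂ × ℂ)
    (hL : ∀ i j, i ≠ j → (L i).1 * (L j).2 - (L j).1 * (L i).2 ≠ 0)
    (hfac : Dpoly A B = C c * ∏ i, lin (L i)) :
    ∃ (M : Matrix (Fin 2) (Fin 2) ℂ) (r n11 n12 n21 n22 : ℂ), IsUnit M.det ∧
      r ≠ 0 ∧ r + 1 ≠ 0 ∧ r + 2 ≠ 0 ∧ r + 3 ≠ 0 ∧ 2 * r + 3 ≠ 0 ∧
      n11 * n22 - n12 * n21 ≠ 0 ∧
      tA M A B = C n11 * m1A r + C n12 * m1B r ∧ tB M A B = C n21 * m1A r + C n22 * m1B r ∧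
      (n21 = 0 ↔ 0 < Set.ncard {i : Fin 4 | lin (L i) ∣ cone A B}) ∧
      (n12 = 0 ↔ 1 < Set.ncard {i : Fin 4 | lin (L i) ∣ cone A B}) ∧
      (n11 + n21 - n12 - n22 = 0 ↔ 2 < Set.ncard {i : Fin 4 | lin (L i) ∣ cone A B}) ∧
      (-(r * (r + 2)) * (n11 * (2 * r + 3) ^ 3 + n12 * (r ^ 2 * (r * (r + 2))))
        + (2 * r + 3) * (n21 * (2 * r + 3) ^ 3 + n22 * (r ^ 2 * (r * (r + 2)))) = 0
        ↔ 3 < Set.ncard {i : Fin 4 | lin (L i) ∣ cone A B}) := by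
  obtain ⟨s, hs⟩ := perm_set {i : Fin 4 | lin (L i) ∣ cone A B}
  obtain ⟨M, r, n11, n12, n21, n22, hM, hr0, hr1, hr2, hr3, hr4, hN, eA, eB, h⟩ :=
    core A B hA hB c hc (fun i => L (s i)) (fun i j hij => hL _ _ (fun h => hij (s.injective h)))
      (by rw [hfac, Equiv.prod_comp s (fun i => lin (L i))])
  obtain ⟨i0, i1, i2, i3⟩ := model_iff r n11 n12 n21 n22 hr1 hr2 hr4
  refine ⟨M, r, n11, n12, n21, n22, hM, hr0, hr1, hr2, hr3, hr4, hN, eA, eB, ?_, ?_, ?_, ?_⟩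
  · rw [← i0, ← h 0]; exact hs 0
  · rw [← i1, ← h 1]; exact hs 1
  · rw [← i2, ← h 2]; exact hs 2
  · rw [← i3, ← h 3]; exact hs 3

lemma model_type (r n11 n12 n21 n22 : ℂ) (k : ℕ) (A B : MvPolynomial (Fin 2) ℂ)
    (hr0 : r ≠ 0) (hr1 : r + 1 ≠ 0) (hr2 : r + 2 ≠ 0) (hr3 : r + 3 ≠ 0)
    (hr4 : 2 * r + 3 ≠ 0) (hN : n11 * n22 - n12 * n21 ≠ 0)
    (eA : A = C n11 * m1A r + C n12 * m1B r) (eB : B = C n21 * m1A r + C n22 * m1B r)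
    (h0 : n21 = 0 ↔ 0 < k) (h1 : n12 = 0 ↔ 1 < k) (h2 : n11 + n21 - n12 - n22 = 0 ↔ 2 < k)
    (h3 : -(r * (r + 2)) * (n11 * (2 * r + 3) ^ 3 + n12 * (r ^ 2 * (r * (r + 2))))
        + (2 * r + 3) * (n21 * (2 * r + 3) ^ 3 + n22 * (r ^ 2 * (r * (r + 2)))) = 0 ↔ 3 < k)
    (hk : k ≤ 4) : HasRedType A B k := by
  subst eA eB
  refine ⟨_, Lr r, ?_, model_L r hr0 hr1 hr2 hr3 hr4, model_D r n11 n12 n21 n22, ?_⟩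
  · exact mul_ne_zero (by norm_num) hN
  · obtain ⟨i0, i1, i2, i3⟩ := model_iff r n11 n12 n21 n22 hr1 hr2 hr4
    have : {i : Fin 4 | lin (Lr r i) ∣ cone (C n11 * m1A r + C n12 * m1B r)
        (C n21 * m1A r + C n22 * m1B r)} = {i : Fin 4 | i.val < k} := by
      ext i
      fin_cases i
      · exact i0.trans h0
      · exact i1.trans h1
      · exact i2.trans h2
      · exact i3.trans h3
    rw [this, Set.ncard_eq_toFinset_card']
    interval_cases k <;> simp <;> decide

/-- **Homogeneous degree-3 foliations with reduced inflection divisor.**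
If `D_H = c·ℓ₁ℓ₂ℓ₃ℓ₄` with `c ∈ ℂ*` and `ℓ₁,…,ℓ₄` pairwise non-proportional linear
forms, then not all four lines divide `C_H = xA + yB`, and according to the number `k`
of the `ℓᵢ` dividing `C_H`, `ω = A dx + B dy` is linearly conjugate to the normal form
of type `k·R₁ + (4−k)·T₁` listed in the paper; moreover each of the four normal forms
(under its parameter constraints) does have reduced inflection divisor with exactly
`3, 2, 1, 0` radial lines respectively. -/
theorem stmt_3 (A B : MvPolynomial (Fin 2) ℂ)
    (hA : A.IsHomogeneous 3) (hB : B.IsHomogeneous 3)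
    (hcop : ∀ p : MvPolynomial (Fin 2) ℂ, p ∣ A → p ∣ B → IsUnit p)
    (c : ℂ) (hc : c ≠ 0) (L : Fin 4 → ℂ × ℂ)
    (hL : ∀ i j, i ≠ j → (L i).1 * (L j).2 - (L j).1 * (L i).2 ≠ 0)
    (hfac : Dpoly A B = C c * ∏ i, lin (L i)) :
    Set.ncard {i : Fin 4 | lin (L i) ∣ cone A B} ≠ 4 ∧
    (Set.ncard {i : Fin 4 | lin (L i) ∣ cone A B} = 3 →
      ∃ r : ℂ, r * (r + 1) * (r + 2) * (r + 3) * (2 * r + 3) ≠ 0 ∧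
        LinConj2 A B (m1A r) (m1B r)) ∧
    (Set.ncard {i : Fin 4 | lin (L i) ∣ cone A B} = 2 →
      ∃ r s : ℂ,
        r * s * (s - 1) * (r + 1) * (r + 2) * (r + 3) * (2 * r + 3) *
            (s * (2 * r + 3) ^ 2 - r ^ 2) ≠ 0 ∧
        LinConj2 A B (C s * m1A r) (m1B r)) ∧
    (Set.ncard {i : Fin 4 | lin (L i) ∣ cone A B} = 1 →
      ∃ r s t : ℂ,
        r * s * t * (r + 1) * (r + 2) * (r + 3) * (2 * r + 3) * (s - t - 1) *
            (t * (2 * r + 3) ^ 3 - r ^ 2 * s * (2 * r + 3) - r ^ 2 * (r * (r + 2))) ≠ 0 ∧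
        LinConj2 A B (C t * m1A r - m1B r) (C s * m1B r)) ∧
    (Set.ncard {i : Fin 4 | lin (L i) ∣ cone A B} = 0 →
      ∃ r s t u : ℂ,
        u * r * (r + 1) * (r + 2) * (r + 3) * (2 * r + 3) * (s * t - 1) *
            (s * u + t - u - 1) *
            (u * (2 * r + 3) ^ 4 + s * u * (r * (r + 2)) * (2 * r + 3) ^ 3 +
              r ^ 2 * t * (r * (r + 2)) * (2 * r + 3) + r ^ 2 * (r * (r + 2)) ^ 2) ≠ 0 ∧
        LinConj2 A B (-(C (s * u)) * m1A r - m1B r) (C u * m1A r + C t * m1B r)) ∧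
    (∀ r : ℂ, r * (r + 1) * (r + 2) * (r + 3) * (2 * r + 3) ≠ 0 →
      HasRedType (m1A r) (m1B r) 3) ∧
    (∀ r s : ℂ,
      r * s * (s - 1) * (r + 1) * (r + 2) * (r + 3) * (2 * r + 3) *
          (s * (2 * r + 3) ^ 2 - r ^ 2) ≠ 0 →
      HasRedType (C s * m1A r) (m1B r) 2) ∧
    (∀ r s t : ℂ,
      r * s * t * (r + 1) * (r + 2) * (r + 3) * (2 * r + 3) * (s - t - 1) *
          (t * (2 * r + 3) ^ 3 - r ^ 2 * s * (2 * r + 3) - r ^ 2 * (r * (r + 2))) ≠ 0 →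
      HasRedType (C t * m1A r - m1B r) (C s * m1B r) 1) ∧
    (∀ r s t u : ℂ,
      u * r * (r + 1) * (r + 2) * (r + 3) * (2 * r + 3) * (s * t - 1) *
          (s * u + t - u - 1) *
          (u * (2 * r + 3) ^ 4 + s * u * (r * (r + 2)) * (2 * r + 3) ^ 3 +
            r ^ 2 * t * (r * (r + 2)) * (2 * r + 3) + r ^ 2 * (r * (r + 2)) ^ 2) ≠ 0 →
      HasRedType (-(C (s * u)) * m1A r - m1B r) (C u * m1A r + C t * m1B r) 0) := by
  obtain ⟨M, r, n11, n12, n21, n22, hM, hr0, hr1, hr2, hr3, hr4, hN, eA, eB, i0, i1, i2, i3⟩ :=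
    classify A B hA hB c hc L hL hfac
  simp only [tA] at eA
  simp only [tB] at eB
  generalize Set.ncard {i : Fin 4 | lin (L i) ∣ cone A B} = k at *
  refine ⟨?_, ?_, ?_, ?_, ?_, ?_, ?_, ?_, ?_⟩
  · rintro rfl
    simp only [Nat.reduceLT, iff_true] at i0 i1 i2 i3
    subst i0 i1
    have e : n11 = n22 := by linear_combination i2
    subst e
    have hn : n11 ≠ 0 := by rintro rfl; simp at hN
    have : 3 * n11 * (r * (r + 2)) * (2 * r + 3) * ((r + 1) * (r + 3)) ≠ 0 := by
      simp_all
    apply this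
    linear_combination -i3
  · rintro rfl
    simp only [Nat.reduceLT, iff_true, iff_false] at i0 i1 i2 i3
    subst i0 i1
    have e : n11 = n22 := by linear_combination i2
    subst e
    have hn : n11 ≠ 0 := by rintro rfl; simp at hN
    refine ⟨r, by simp_all, M, n11, hM, hn, ?_, ?_⟩
    · rw [eA]; simp
    · rw [eB]; simp
  · rintro rfl
    simp only [Nat.reduceLT, iff_true, iff_false] at i0 i1 i2 i3
    subst i0 i1
    have hn1 : n11 ≠ 0 := by rintro rfl; simp at hN
    have hn : n22 ≠ 0 := by rintro rfl; simp at hN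
    have hs : n22 * (n11 / n22) = n11 := by field_simp
    obtain ⟨s, hs'⟩ : ∃ s, s = n11 / n22 := ⟨_, rfl⟩
    rw [← hs'] at hs
    subst hs
    refine ⟨r, s, ?_, M, n22, hM, hn, ?_, ?_⟩
    · have g0 : s ≠ 0 := by rintro rfl; simp at hN
      have g1 : s - 1 ≠ 0 := by
        intro h; apply i2; linear_combination n22 * h
      have g2 : s * (2 * r + 3) ^ 2 - r ^ 2 ≠ 0 := by
        intro h; apply i3
        linear_combination (-n22 * r * (r + 2) * (2 * r + 3)) * h
      simp only [ne_eq, mul_eq_zero, not_or]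
      tauto
    · rw [eA]; simp [mul_assoc]
    · rw [eB]; simp
  · rintro rfl
    simp only [Nat.reduceLT, iff_true, iff_false] at i0 i1 i2 i3
    subst i0
    obtain ⟨m, rfl⟩ : ∃ m, n12 = -m := ⟨-n12, by ring⟩
    have hm : m ≠ 0 := by simpa using i1
    obtain ⟨s, rfl⟩ : ∃ s, n22 = m * s := ⟨n22 / m, by field_simp⟩
    obtain ⟨t, rfl⟩ : ∃ t, n11 = m * t := ⟨n11 / m, by field_simp⟩
    refine ⟨r, s, t, ?_, M, m, hM, hm, ?_, ?_⟩
    · have g0 : s ≠ 0 := by rintro rfl; simp at hN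
      have g0' : t ≠ 0 := by rintro rfl; simp at hN
      have g1 : s - t - 1 ≠ 0 := by
        intro h; apply i2; linear_combination -m * h
      have g2 : t * (2 * r + 3) ^ 3 - r ^ 2 * s * (2 * r + 3) - r ^ 2 * (r * (r + 2)) ≠ 0 := by
        intro h; apply i3
        linear_combination (-m * r * (r + 2)) * h
      rw [mul_ne_zero_iff, mul_ne_zero_iff]
      refine ⟨⟨?_, g1⟩, g2⟩
      simp only [ne_eq, mul_eq_zero, not_or]
      tauto
    · rw [eA]; simp only [C_mul, C_neg]; ring
    · rw [eB]; simp only [C_mul, C_0]; ring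
  · rintro rfl
    simp only [Nat.reduceLT, iff_false] at i0 i1 i2 i3
    obtain ⟨m, rfl⟩ : ∃ m, n12 = -m := ⟨-n12, by ring⟩
    have hm : m ≠ 0 := by simpa using i1
    obtain ⟨t, rfl⟩ : ∃ t, n22 = m * t := ⟨n22 / m, by field_simp⟩
    obtain ⟨u, rfl⟩ : ∃ u, n21 = m * u := ⟨n21 / m, by field_simp⟩
    have hu : u ≠ 0 := by rintro rfl; simp at i0
    obtain ⟨s, rfl⟩ : ∃ s, n11 = -(m * (s * u)) := ⟨-n11 / (m * u), by field_simp⟩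
    refine ⟨r, s, t, u, ?_, M, m, hM, hm, ?_, ?_⟩
    · have g0 : s * t - 1 ≠ 0 := by
        intro h; apply hN; linear_combination -(m ^ 2 * u) * h
      have g1 : s * u + t - u - 1 ≠ 0 := by
        intro h; apply i2; linear_combination -m * h
      have g2 : u * (2 * r + 3) ^ 4 + s * u * (r * (r + 2)) * (2 * r + 3) ^ 3 +
              r ^ 2 * t * (r * (r + 2)) * (2 * r + 3) + r ^ 2 * (r * (r + 2)) ^ 2 ≠ 0 := by
        intro h; apply i3
        linear_combination m * h
      rw [mul_ne_zero_iff, mul_ne_zero_iff, mul_ne_zero_iff]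
      refine ⟨⟨⟨?_, g0⟩, g1⟩, g2⟩
      simp only [ne_eq, mul_eq_zero, not_or]
      tauto
    · rw [eA]; simp only [C_mul, C_neg]; ring
    · rw [eB]; simp only [C_mul]; ring
  · clear * -
    intro r h
    simp only [ne_eq, mul_eq_zero, not_or] at h
    obtain ⟨⟨⟨⟨h0, h1⟩, h2⟩, h3⟩, h4⟩ := h
    refine model_type r 1 0 0 1 3 _ _ h0 h1 h2 h3 h4 (by simp) (by simp) (by simp) (by simp)
      (by simp) (by simp) ?_ (by norm_num)
    simp only [lt_irrefl, iff_false]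
    have : -(3 * (r * (r + 2)) * (2 * r + 3) * ((r + 1) * (r + 3))) ≠ 0 := by
      simp_all
    intro h
    apply this
    linear_combination h
  · clear * -
    intro r s h
    rw [mul_ne_zero_iff] at h
    obtain ⟨h, h7⟩ := h
    simp only [ne_eq, mul_eq_zero, not_or] at h
    obtain ⟨⟨⟨⟨⟨⟨h0, h5⟩, h6⟩, h1⟩, h2⟩, h3⟩, h4⟩ := h
    refine model_type r s 0 0 1 2 _ _ h0 h1 h2 h3 h4 (by simpa using h5) (by simp) (by simp)
      (by simp) (by simp) ?_ ?_ (by norm_num)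
    · simpa using h6
    · simp only [Nat.reduceLT, iff_false]
      intro h
      apply mul_ne_zero (mul_ne_zero (mul_ne_zero h0 h2) h4) h7
      linear_combination -h
  · clear * -
    intro r s t h
    rw [mul_ne_zero_iff, mul_ne_zero_iff] at h
    obtain ⟨⟨h, h7⟩, h8⟩ := h
    simp only [ne_eq, mul_eq_zero, not_or] at h
    obtain ⟨⟨⟨⟨⟨⟨h0, h5⟩, h6⟩, h1⟩, h2⟩, h3⟩, h4⟩ := h
    refine model_type r t (-1) 0 s 1 _ _ h0 h1 h2 h3 h4 (by simp [h5, h6])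
      (by simp [sub_eq_add_neg]) (by simp)
      (by simp) (by simp) ?_ ?_ (by norm_num)
    · simp only [Nat.reduceLT, iff_false]
      intro h; apply h7; linear_combination -h
    · simp only [Nat.reduceLT, iff_false]
      intro h
      apply mul_ne_zero (mul_ne_zero h0 h2) h8
      linear_combination -h
  · clear * -
    intro r s t u h
    rw [mul_ne_zero_iff, mul_ne_zero_iff, mul_ne_zero_iff] at h
    obtain ⟨⟨⟨h, h6⟩, h7⟩, h8⟩ := h
    simp only [ne_eq, mul_eq_zero, not_or] at h
    obtain ⟨⟨⟨⟨⟨h5, h0⟩, h1⟩, h2⟩, h3⟩, h4⟩ := h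
    refine model_type r (-(s * u)) (-1) u t 0 _ _ h0 h1 h2 h3 h4 ?_
      (by simp [sub_eq_add_neg]) (by simp)
      (by simp [h5]) (by simp) ?_ ?_ (by norm_num)
    · intro h
      apply mul_ne_zero h5 h6
      linear_combination -h
    · simp only [Nat.reduceLT, iff_false]
      intro h; apply h7; linear_combination -h
    · simp only [Nat.reduceLT, iff_false]
      intro h; apply h8; linear_combination h
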